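/- Suppose the decision-theoretic kernel p(W_V | F_A) obeys distributional consistency. Let B and C be disjoint subsets of A (C possibly empty). Then for every c ∈ 𝔛_C and every v ∈ 𝔛_V: p(W_V = v | F_B = v_B, F_C = c) = p(W_V = v | F_B = ∅, F_C = c), i.e., a regime that sets each indicator in B to the value that the corresponding variable actually takes has no effect on the joint distribution. -/

import Mathlib

open Finset

namespace CausalPaper

variable {V : Type*} [Fintype V] [DecidableEq V]
variable {𝔛 : V → Type*} [∀ i, Fintype (𝔛 i)]

/-- Probability of the event `E` under the distribution `q` on joint assignments. -/
noncomputable def pr (q : (∀ i, 𝔛 i) → ℝ) (E : (∀ i, 𝔛 i) → Prop) : ℝ :=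
  ∑ v : (∀ i, 𝔛 i), Set.indicator (setOf E) q v

/-- Conditional probability of `E` given `F` under `q`. -/
noncomputable def cpr (q : (∀ i, 𝔛 i) → ℝ) (E F : (∀ i, 𝔛 i) → Prop) : ℝ :=
  pr q (fun v => E v ∧ F v) / pr q F

/-- `q` is a probability distribution on joint assignments. -/
def IsProb (q : (∀ i, 𝔛 i) → ℝ) : Prop :=
  (∀ v, 0 ≤ q v) ∧ (∑ v : (∀ i, 𝔛 i), q v) = 1

/-- `v` agrees with `s` on the coordinates in `S`. -/
def agree (S : Finset V) (s v : ∀ i, 𝔛 i) : Prop :=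
  ∀ i ∈ S, v i = s i

/-- The intervention/regime that sets the variables in `B` according to `b`
(and is idle elsewhere). -/
def setOn (B : Finset V) (b : ∀ i, 𝔛 i) : ∀ i, Option (𝔛 i) :=
  fun i => if i ∈ B then some (b i) else none

/-- The intervention/regime that sets `B` according to `b` and `C` according to `c`. -/
def setOn₂ (B : Finset V) (b : ∀ i, 𝔛 i) (C : Finset V) (c : ∀ i, 𝔛 i) :
    ∀ i, Option (𝔛 i) :=
  fun i => if i ∈ B then some (b i) else if i ∈ C then some (c i) else none

/-- The support of the partial intervention/regime `f` is contained in `A`. -/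
def suppIn (f : ∀ i, Option (𝔛 i)) (A : Finset V) : Prop :=
  ∀ i, f i ≠ none → i ∈ A

/-- Distributional consistency: for `i ∈ A`, `C ⊆ A \ {i}`, the probability of the
event `{X_{V∖{i}} = y, X_i = b}` is the same whether or not `i` is additionally
intervened on and set to `b`. -/
def DistConsistent (A : Finset V) (P : (∀ i, Option (𝔛 i)) → (∀ i, 𝔛 i) → ℝ) : Prop :=
  ∀ i ∈ A, ∀ C : Finset V, C ⊆ A \ {i} →
    ∀ (y : ∀ j, 𝔛 j) (b : 𝔛 i) (c : ∀ j, 𝔛 j),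
      pr (P (Function.update (setOn C c) i (some b)))
          (fun v => agree (univ \ {i}) y v ∧ v i = b)
        = pr (P (setOn C c)) (fun v => agree (univ \ {i}) y v ∧ v i = b)

theorem setOn₂_eq_setOn_union (B : Finset V) (b : ∀ i, 𝔛 i) (C : Finset V) (c : ∀ i, 𝔛 i) :
    setOn₂ B b C c = setOn (B ∪ C) (fun j => if j ∈ B then b j else c j) := by
  funext j
  by_cases hB : j ∈ B <;> simp [setOn₂, setOn, hB]

theorem setOn₂_empty (b : ∀ i, 𝔛 i) (C : Finset V) (c : ∀ i, 𝔛 i) :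
    setOn₂ ∅ b C c = setOn C c := by
  funext j
  simp [setOn₂, setOn]

theorem setOn₂_insert (i : V) (B : Finset V) (b : ∀ i, 𝔛 i) (C : Finset V) (c : ∀ i, 𝔛 i) :
    setOn₂ (insert i B) b C c = Function.update (setOn₂ B b C c) i (some (b i)) := by
  funext j
  by_cases h : j = i
  · subst h
    simp [setOn₂]
  · simp [setOn₂, h]

theorem agree_sdiff_singleton_and_iff (i : V) (s v : ∀ j, 𝔛 j) :
    (agree (univ \ {i}) s v ∧ v i = s i) ↔ agree univ s v := by
  constructor
  · rintro ⟨h, hi⟩ j -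
    by_cases hj : j = i
    · exact hj ▸ hi
    · exact h j (by simp [hj])
  · exact fun h => ⟨fun j _ => h j (mem_univ j), h i (mem_univ i)⟩

/-- Decision-theoretic distributional consistency for a set `B`: a regime that sets
each indicator in `B` to the value the corresponding variable actually takes has
no effect on the joint distribution. -/
theorem stmt9_kernel_dist_consistency_vector
    (A B C : Finset V) (hBA : B ⊆ A) (hCA : C ⊆ A) (hBC : Disjoint B C)
    (P : (∀ i, Option (𝔛 i)) → (∀ i, 𝔛 i) → ℝ)
    (hP : ∀ f, suppIn f A → IsProb (P f))
    (hDC : DistConsistent A P)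
    (c v : ∀ j, 𝔛 j) :
    pr (P (setOn₂ B v C c)) (agree univ v) = pr (P (setOn C c)) (agree univ v) := by
  clear hP
  induction B using Finset.induction_on with
  | empty => rw [setOn₂_empty]
  | insert i B hi ih =>
    rw [insert_subset_iff] at hBA
    rw [disjoint_insert_left] at hBC
    rw [← ih hBA.2 hBC.2, setOn₂_insert, setOn₂_eq_setOn_union]
    have hsub : B ∪ C ⊆ A \ {i} := by
      rw [sdiff_singleton_eq_erase, subset_erase]
      exact ⟨union_subset hBA.2 hCA, by simp [hi, hBC.1]⟩
    simpa only [agree_sdiff_singleton_and_iff] using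
      hDC i hBA.1 (B ∪ C) hsub v (v i) (fun j => if j ∈ B then v j else c j)

end CausalPaper
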